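/- arXiv:2408.05675 — 2 statements merged into one kernel-verified Lean document; each statement's English description precedes it below -/
import Mathlib

section
/- Let n ≥ 2, α ∈ (0,1), R > 0, m > 0, and let g : ℝⁿ → [0,∞) be measurable with S = sup_{B_R} g < ∞. Assume the sharp quantitative fractional isoperimetric inequality holds with a constant c = c(n,α) > 0: for every measurable F ⊆ ℝⁿ with |F| = |B_1| and P_α(F) < ∞, P_α(F)/P_α(B_1) − 1 ≥ c · inf_{x ∈ ℝⁿ} ( |F Δ (x + B_1)| / |B_1| )². Let E_m ⊆ B_R be a minimizer of 𝓔 among measurable sets of volume m, with the ball of volume m contained in B_R, and set γ = (|B_1|/m)^{1/n}. Then there exists a ∈ ℝⁿ such that |γ E_m Δ (a + B_1)| ≤ |B_1| · ( c^{−1} · |B_1|^{(n−α)/n} · P_α(B_1)^{−1} · S )^{1/2} · m^{α/(2n)}. -/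
open MeasureTheory Metric Set
open scoped ENNReal

/-- The fractional (nonlocal) perimeter `P_α(E) = ∫_E ∫_{Eᶜ} |x-y|^{-(n+α)} dy dx`. -/
noncomputable def fracPerimeter (n : ℕ) (α : ℝ) (E : Set (EuclideanSpace ℝ (Fin n))) : ℝ≥0∞ :=
  ∫⁻ x in E, ∫⁻ y in Eᶜ, ENNReal.ofReal (‖x - y‖ ^ (-((n : ℝ) + α)))

/-- The nonlocal free energy `𝓔(E) = P_α(E) + ∫_E g`. -/
noncomputable def freeEnergy (n : ℕ) (α : ℝ) (g : EuclideanSpace ℝ (Fin n) → ℝ)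
    (E : Set (EuclideanSpace ℝ (Fin n))) : ℝ≥0∞ :=
  fracPerimeter n α E + ∫⁻ x in E, ENNReal.ofReal (g x)

open Filter Topology

/-- Among the translates of a bounded measurable set `B`, one is closest in measure to a given
bounded measurable set `F`. -/
theorem exists_forall_volume_symmDiff_translate_le {n : ℕ} {F B : Set (EuclideanSpace ℝ (Fin n))}
    (hF : MeasurableSet F) (hB : MeasurableSet B)
    (hFb : Bornology.IsBounded F) (hBb : Bornology.IsBounded B) :
    ∃ a : EuclideanSpace ℝ (Fin n), ∀ x : EuclideanSpace ℝ (Fin n),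
      volume (symmDiff F ((fun y => a + y) '' B)) ≤ volume (symmDiff F ((fun y => x + y) '' B)) := by
  have hmeas (x : EuclideanSpace ℝ (Fin n)) : MeasurableSet ((fun y => x + y) '' B) :=
    (MeasurableEquiv.addLeft x).measurableSet_image.2 hB
  let G : EuclideanSpace ℝ (Fin n) → MeasuredSets (volume : Measure (EuclideanSpace ℝ (Fin n))) :=
    fun x => ⟨(fun y => x + y) '' B, hmeas x⟩
  have hG : Continuous G := by
    rw [continuous_iff_continuousAt]
    intro x
    rw [ContinuousAt, tendsto_iff_edist_tendsto_0]
    let f : EuclideanSpace ℝ (Fin n) → C(EuclideanSpace ℝ (Fin n), EuclideanSpace ℝ (Fin n)) :=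
      fun x => ⟨fun y => -x + y, by fun_prop⟩
    have hf : Continuous f :=
      ContinuousMap.continuous_of_continuous_uncurry _
        (show Continuous fun p : EuclideanSpace ℝ (Fin n) × EuclideanSpace ℝ (Fin n) =>
          -p.1 + p.2 by fun_prop)
    have hp (x) : MeasurePreserving (f x) volume volume :=
      measurePreserving_add_left volume (-x)
    have := tendsto_measure_symmDiff_preimage_nhds_zero (hf.tendsto x)
      (Eventually.of_forall hp) (hp x) hB.nullMeasurableSet hBb.measure_lt_top.ne
    simp_rw [MeasuredSets.edist_def, G, image_add_left]
    exact this
  have hcont : Continuous fun x => volume (symmDiff F ((fun y => x + y) '' B)) :=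
    let F' : MeasuredSets (volume : Measure (EuclideanSpace ℝ (Fin n))) := ⟨F, hF⟩
    (continuous_const (y := F')).edist hG
  refine hcont.exists_forall_le' 0 ?_
  obtain ⟨M, hM⟩ := hFb.subset_closedBall 0
  obtain ⟨N, hN⟩ := hBb.subset_closedBall 0
  filter_upwards [(tendsto_norm_cocompact_atTop (E := EuclideanSpace ℝ (Fin n))).eventually_gt_atTop
    (M + N)] with x hx
  have hdisj : Disjoint F ((fun y => x + y) '' B) := by
    rw [Set.disjoint_left]
    rintro _ hz ⟨y, hy, rfl⟩
    have h1 := hM hz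
    have h2 := hN hy
    simp only [mem_closedBall, dist_zero_right] at h1 h2
    have := norm_sub_le (x + y) y
    rw [add_sub_cancel_right] at this
    linarith
  rw [hdisj.symmDiff_eq_sup]
  change _ ≤ volume (F ∪ _)
  rw [measure_union hdisj (hmeas x)]
  refine (measure_mono symmDiff_subset_union).trans ((measure_union_le _ _).trans ?_)
  simp [image_add_left, measure_preimage_add]

/-- Change of variables under a dilation, for the Lebesgue integral over a set. -/
theorem setLIntegral_image_smul {n : ℕ} {r : ℝ} (hr : 0 < r) (E : Set (EuclideanSpace ℝ (Fin n)))
    (f : EuclideanSpace ℝ (Fin n) → ℝ≥0∞) :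
    ∫⁻ x in (fun x => r • x) '' E, f x = ENNReal.ofReal (r ^ n) * ∫⁻ x in E, f (r • x) := by
  let e := (Homeomorph.smulOfNeZero (α := EuclideanSpace ℝ (Fin n)) r hr.ne').toMeasurableEquiv
  have he : ⇑e = fun x => r • x := rfl
  have hmap : volume.map e =
      ENNReal.ofReal (r ^ n)⁻¹ • (volume : Measure (EuclideanSpace ℝ (Fin n))) := by
    rw [he, Measure.map_addHaar_smul volume hr.ne', finrank_euclideanSpace_fin,
      abs_of_pos (by positivity)]
  have h := lintegral_map_equiv (μ := volume.restrict E) f e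
  rw [← he]
  have hE : volume.restrict E = volume.restrict (e ⁻¹' (e '' E)) := by
    rw [e.injective.preimage_image]
  have h1 : ENNReal.ofReal (r ^ n) * ENNReal.ofReal (r ^ n)⁻¹ = 1 := by
    rw [← ENNReal.ofReal_mul (by positivity), mul_inv_cancel₀ (by positivity), ENNReal.ofReal_one]
  rw [hE, ← e.restrict_map, hmap, Measure.restrict_smul, lintegral_smul_measure, smul_eq_mul,
    ← hE] at h
  change _ = _ * ∫⁻ x in E, f (e x)
  rw [← h, ← mul_assoc, h1, one_mul]

/-- The fractional perimeter is homogeneous of degree `n - α`. -/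
theorem fracPerimeter_image_smul {n : ℕ} (α : ℝ) {r : ℝ} (hr : 0 < r)
    (E : Set (EuclideanSpace ℝ (Fin n))) :
    fracPerimeter n α ((fun x => r • x) '' E) =
      ENNReal.ofReal (r ^ ((n : ℝ) - α)) * fracPerimeter n α E := by
  have hbij : Function.Bijective fun x : EuclideanSpace ℝ (Fin n) => r • x :=
    (Homeomorph.smulOfNeZero r hr.ne').bijective
  have hk (x y : EuclideanSpace ℝ (Fin n)) :
      ENNReal.ofReal (‖r • x - r • y‖ ^ (-((n : ℝ) + α))) =
        ENNReal.ofReal (r ^ (-((n : ℝ) + α))) * ENNReal.ofReal (‖x - y‖ ^ (-((n : ℝ) + α))) := by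
    rw [← ENNReal.ofReal_mul (by positivity), ← smul_sub, norm_smul, Real.norm_of_nonneg hr.le,
      Real.mul_rpow hr.le (norm_nonneg _)]
  have hpow : ENNReal.ofReal (r ^ n) *
      (ENNReal.ofReal (r ^ n) * ENNReal.ofReal (r ^ (-((n : ℝ) + α)))) =
        ENNReal.ofReal (r ^ ((n : ℝ) - α)) := by
    rw [← ENNReal.ofReal_mul (by positivity), ← ENNReal.ofReal_mul (by positivity),
      ← Real.rpow_natCast, ← Real.rpow_add hr, ← Real.rpow_add hr]
    congr 2
    ring
  simp only [fracPerimeter, ← image_compl_eq hbij, setLIntegral_image_smul hr, hk]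
  simp_rw [lintegral_const_mul' _ _ ENNReal.ofReal_ne_top]
  rw [← hpow]
  simp only [mul_assoc]

/-- The fractional perimeter is positive when neither the set nor its complement is null. -/
theorem fracPerimeter_ne_zero {n : ℕ} (α : ℝ) {E : Set (EuclideanSpace ℝ (Fin n))}
    (h0 : volume E ≠ 0) (h0' : volume Eᶜ ≠ 0) : fracPerimeter n α E ≠ 0 := by
  have hmeas : Measurable fun p : EuclideanSpace ℝ (Fin n) × EuclideanSpace ℝ (Fin n) =>
      ENNReal.ofReal (‖p.1 - p.2‖ ^ (-((n : ℝ) + α))) := by fun_prop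
  have hinner (x) (hx : x ∈ E) :
      0 < ∫⁻ y in Eᶜ, ENNReal.ofReal (‖x - y‖ ^ (-((n : ℝ) + α))) := by
    rw [setLIntegral_pos_iff (by fun_prop)]
    refine (pos_iff_ne_zero.2 h0').trans_le (measure_mono fun y hy => ⟨?_, hy⟩)
    have hxy : x - y ≠ 0 := sub_ne_zero.2 fun h => hy (h ▸ hx)
    have := norm_pos_iff.2 hxy
    simp only [Function.mem_support, ne_eq, ENNReal.ofReal_eq_zero, not_le]
    positivity
  refine ne_of_gt ?_
  rw [fracPerimeter, setLIntegral_pos_iff hmeas.lintegral_prod_right']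
  exact (pos_iff_ne_zero.2 h0).trans_le (measure_mono fun x hx => ⟨(hinner x hx).ne', hx⟩)

/-- Assuming the sharp quantitative fractional isoperimetric inequality, any minimizer of
volume `m` in `B_R`, rescaled to unit volume, is close to some unit ball, quantitatively. -/
theorem stmt_16 (n : ℕ) (hn : 2 ≤ n) (α : ℝ) (hα : α ∈ Set.Ioo (0 : ℝ) 1)
    (R m : ℝ) (hR : 0 < R) (hm : 0 < m)
    (g : EuclideanSpace ℝ (Fin n) → ℝ) (hgmeas : Measurable g) (hg0 : ∀ x, 0 ≤ g x)
    (S : ℝ) (hS : ∀ x ∈ ball (0 : EuclideanSpace ℝ (Fin n)) R, g x ≤ S)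
    (c : ℝ) (hc : 0 < c)
    (hquant : ∀ F : Set (EuclideanSpace ℝ (Fin n)), MeasurableSet F →
      volume F = volume (ball (0 : EuclideanSpace ℝ (Fin n)) 1) →
      fracPerimeter n α F ≠ ⊤ →
      fracPerimeter n α F / fracPerimeter n α (ball (0 : EuclideanSpace ℝ (Fin n)) 1) - 1
        ≥ ENNReal.ofReal c *
            (⨅ x : EuclideanSpace ℝ (Fin n),
              volume (symmDiff F ((fun y => x + y) '' ball (0 : EuclideanSpace ℝ (Fin n)) 1))
                / volume (ball (0 : EuclideanSpace ℝ (Fin n)) 1)) ^ 2)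
    (Em : Set (EuclideanSpace ℝ (Fin n))) (hEmmeas : MeasurableSet Em)
    (hEmR : Em ⊆ ball (0 : EuclideanSpace ℝ (Fin n)) R)
    (hEmvol : volume Em = ENNReal.ofReal m)
    (hEmfin : freeEnergy n α g Em ≠ ⊤)
    (hEmmin : ∀ F : Set (EuclideanSpace ℝ (Fin n)), MeasurableSet F →
      volume F = ENNReal.ofReal m → freeEnergy n α g Em ≤ freeEnergy n α g F)
    (hballR : ball (0 : EuclideanSpace ℝ (Fin n))
        ((m / (volume (ball (0 : EuclideanSpace ℝ (Fin n)) 1)).toReal) ^ ((1 : ℝ) / n))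
      ⊆ ball (0 : EuclideanSpace ℝ (Fin n)) R) :
    ∃ a : EuclideanSpace ℝ (Fin n),
      volume (symmDiff
          ((fun x => (((volume (ball (0 : EuclideanSpace ℝ (Fin n)) 1)).toReal / m)
              ^ ((1 : ℝ) / n)) • x) '' Em)
          ((fun y => a + y) '' ball (0 : EuclideanSpace ℝ (Fin n)) 1))
        ≤ volume (ball (0 : EuclideanSpace ℝ (Fin n)) 1) *
            ENNReal.ofReal
              (Real.sqrt (c⁻¹ *
                  (volume (ball (0 : EuclideanSpace ℝ (Fin n)) 1)).toReal ^ (((n : ℝ) - α) / n) *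
                  (fracPerimeter n α (ball (0 : EuclideanSpace ℝ (Fin n)) 1)).toReal⁻¹ * S) *
                m ^ (α / (2 * n))) := by
  set B : Set (EuclideanSpace ℝ (Fin n)) := ball 0 1 with hB
  set P := fracPerimeter n α B with hP
  set b := (volume B).toReal with hb
  have hn0 : (n : ℝ) ≠ 0 := by positivity
  have : Nontrivial (EuclideanSpace ℝ (Fin n)) :=
    Module.nontrivial_of_finrank_pos (R := ℝ) (by rw [finrank_euclideanSpace_fin]; lia)
  have hBtop : volume B ≠ ⊤ := measure_ball_lt_top.ne
  have hB0 : volume B ≠ 0 := (measure_ball_pos volume _ one_pos).ne'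
  have hbpos : 0 < b := ENNReal.toReal_pos hB0 hBtop
  have hbof : ENNReal.ofReal b = volume B := ENNReal.ofReal_toReal hBtop
  have hS0 : 0 ≤ S := (hg0 0).trans (hS 0 (mem_ball_self hR))
  have hP0 : P ≠ 0 := by
    refine fracPerimeter_ne_zero α hB0 fun h => ?_
    have h1 := measure_add_measure_compl (μ := volume) (s := B) measurableSet_ball
    rw [h, add_zero, measure_univ_of_isAddLeftInvariant] at h1
    exact hBtop h1
  have hvol (r : ℝ) (hr : 0 < r) (E : Set (EuclideanSpace ℝ (Fin n))) :
      volume ((fun x => r • x) '' E) = ENNReal.ofReal (r ^ n) * volume E := by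
    simpa using setLIntegral_image_smul hr E 1
  have hroot (t : ℝ) (ht : 0 < t) : (t ^ ((1 : ℝ) / n)) ^ n = t := by
    rw [one_div, Real.rpow_inv_natCast_pow ht.le (by lia)]
  set γ := (b / m) ^ ((1 : ℝ) / n) with hγ
  set r := (m / b) ^ ((1 : ℝ) / n) with hr
  have hγpos : 0 < γ := by positivity
  have hrpos : 0 < r := by positivity
  have hγr : γ * r = 1 := by
    rw [hγ, hr, ← Real.mul_rpow (by positivity) (by positivity), div_mul_div_cancel₀ hm.ne',
      div_self hbpos.ne', Real.one_rpow]
  set F := (fun x : EuclideanSpace ℝ (Fin n) => γ • x) '' Em with hF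
  have hFmeas : MeasurableSet F :=
    (Homeomorph.smulOfNeZero (α := EuclideanSpace ℝ (Fin n)) γ
      hγpos.ne').toMeasurableEquiv.measurableSet_image.2 hEmmeas
  have hFvol : volume F = volume B := by
    rw [hF, hvol γ hγpos, hEmvol, hroot _ (by positivity), ← ENNReal.ofReal_mul (by positivity),
      div_mul_cancel₀ _ hm.ne', hbof]
  have hFbdd : Bornology.IsBounded F :=
    (isBounded_ball.subset hEmR).smul₀ γ
  have hFper : fracPerimeter n α F = ENNReal.ofReal (γ ^ ((n : ℝ) - α)) * fracPerimeter n α Em :=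
    fracPerimeter_image_smul α hγpos Em
  have hEmper : fracPerimeter n α Em ≠ ⊤ := ne_top_of_le_ne_top hEmfin le_self_add
  have hball : ball (0 : EuclideanSpace ℝ (Fin n)) r = (fun x => r • x) '' B := by
    rw [image_smul, hB, smul_unitBall_of_pos hrpos]
  have hballvol : volume (ball (0 : EuclideanSpace ℝ (Fin n)) r) = ENNReal.ofReal m := by
    rw [hball, hvol r hrpos, hroot _ (by positivity), ← hbof, ← ENNReal.ofReal_mul (by positivity),
      div_mul_cancel₀ _ hbpos.ne']
  have hg : ∫⁻ x in ball (0 : EuclideanSpace ℝ (Fin n)) r, ENNReal.ofReal (g x) ≤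
      ENNReal.ofReal (S * m) := by
    rw [ENNReal.ofReal_mul hS0, ← hballvol, ← setLIntegral_const]
    exact setLIntegral_mono measurable_const fun x hx => ENNReal.ofReal_le_ofReal (hS x (hballR hx))
  have hEmle : fracPerimeter n α Em ≤
      ENNReal.ofReal (r ^ ((n : ℝ) - α)) * P + ENNReal.ofReal (S * m) :=
    calc fracPerimeter n α Em ≤ freeEnergy n α g Em := le_self_add
      _ ≤ freeEnergy n α g (ball 0 r) := hEmmin _ measurableSet_ball hballvol
      _ ≤ _ := by
        rw [freeEnergy, hball, fracPerimeter_image_smul α hrpos, ← hball]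
        gcongr
  set T := γ ^ ((n : ℝ) - α) * (S * m) with hT
  have hT0 : 0 ≤ T := by positivity
  have hFle : fracPerimeter n α F ≤ P + ENNReal.ofReal T := by
    rw [hFper]
    refine (mul_le_mul_right hEmle _).trans_eq ?_
    rw [mul_add, ← mul_assoc, ← ENNReal.ofReal_mul (by positivity),
      ← ENNReal.ofReal_mul (by positivity), ← Real.mul_rpow hγpos.le hrpos.le, hγr, Real.one_rpow,
      ENNReal.ofReal_one, one_mul]
  obtain ⟨a, ha⟩ := exists_forall_volume_symmDiff_translate_le hFmeas
    (measurableSet_ball (x := (0 : EuclideanSpace ℝ (Fin n))) (ε := 1)) hFbdd isBounded_ball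
  refine ⟨a, ?_⟩
  set V := volume (symmDiff F ((fun y => a + y) '' B)) with hV
  have hdef : ENNReal.ofReal c * (V / volume B) ^ 2 ≤ ENNReal.ofReal (T * P.toReal⁻¹) :=
    calc ENNReal.ofReal c * (V / volume B) ^ 2
        ≤ _ := by
          gcongr
          exact le_iInf fun x => ENNReal.div_le_div_right (ha x) _
      _ ≤ fracPerimeter n α F / P - 1 :=
          hquant F hFmeas hFvol (by rw [hFper]; finiteness)
      _ ≤ ENNReal.ofReal T / P := by
          rw [tsub_le_iff_left]
          calc fracPerimeter n α F / P ≤ (P + ENNReal.ofReal T) / P := by gcongr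
            _ ≤ 1 + ENNReal.ofReal T / P := by
              rw [ENNReal.add_div]
              gcongr
              exact ENNReal.div_self_le_one
      _ = ENNReal.ofReal (T * P.toReal⁻¹) := by
          rw [ENNReal.ofReal_mul hT0, div_eq_mul_inv, ← ENNReal.toReal_inv,
            ENNReal.ofReal_toReal (ENNReal.inv_ne_top.2 hP0)]
  have hTeq : T = b ^ (((n : ℝ) - α) / n) * S * m ^ (α / n) := by
    have h1 : γ ^ ((n : ℝ) - α) = b ^ (((n : ℝ) - α) / n) / m ^ (((n : ℝ) - α) / n) := by
      rw [hγ, ← Real.rpow_mul (by positivity), Real.div_rpow hbpos.le hm.le, one_div_mul_eq_div]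
    have h2 : m = m ^ (((n : ℝ) - α) / n) * m ^ (α / n) := by
      rw [← Real.rpow_add hm, ← add_div, sub_add_cancel, div_self hn0, Real.rpow_one]
    have h3 : m ^ (((n : ℝ) - α) / n) ≠ 0 := by positivity
    rw [hT, h1]
    nth_rewrite 2 [h2]
    field_simp
  set D := Real.sqrt (c⁻¹ * b ^ (((n : ℝ) - α) / n) * P.toReal⁻¹ * S) * m ^ (α / (2 * n)) with hD
  have hD0 : 0 ≤ D := by positivity
  have hDsq : c * D ^ 2 = T * P.toReal⁻¹ := by
    have h1 : (m ^ (α / (2 * n))) ^ 2 = m ^ (α / n) := by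
      rw [← Real.rpow_mul_natCast hm.le]
      congr 1
      push_cast
      field_simp
    rw [hD, mul_pow, Real.sq_sqrt (by positivity), h1, hTeq]
    field_simp
  have hVD : V / volume B ≤ ENNReal.ofReal D := by
    rw [← hDsq, ENNReal.ofReal_mul hc.le, ENNReal.ofReal_pow hD0,
      ENNReal.mul_le_mul_iff_right (by simpa using hc) ENNReal.ofReal_ne_top] at hdef
    exact (ENNReal.pow_le_pow_left_iff two_ne_zero).1 hdef
  rwa [mul_comm, ← ENNReal.div_le_iff hB0 hBtop]
end

section
/- Let n ≥ 1, α ∈ (0,1), R > 0, and let (E_k) be a sequence of measurable subsets of the ball B_R ⊆ ℝⁿ with sup_k P_α(E_k) < ∞. Then there exist a subsequence (E_{k_j}) and a measurable set E ⊆ B_R such that |E_{k_j} Δ E| → 0 as j → ∞. -/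
open MeasureTheory Metric Set Filter
open scoped ENNReal Topology

/-- The cell of the cubic grid of mesh `h` with index `v`. -/
def gridCube {n : ℕ} (h : ℝ) (v : Fin n → ℤ) : Set (EuclideanSpace ℝ (Fin n)) :=
  {x | ∀ i, ⌊x i / h⌋ = v i}

section GridCube

variable {n : ℕ} {h : ℝ}

lemma gridCube_eq_preimage (hh : 0 < h) (v : Fin n → ℤ) :
    gridCube h v = WithLp.ofLp ⁻¹'
      (Set.univ.pi fun i => Set.Ico ((v i : ℝ) * h) (((v i : ℝ) + 1) * h)) := by
  ext x
  simp [gridCube, Int.floor_eq_iff, le_div_iff₀ hh, div_lt_iff₀ hh]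

lemma measurableSet_gridCube (hh : 0 < h) (v : Fin n → ℤ) : MeasurableSet (gridCube h v) := by
  rw [gridCube_eq_preimage hh]
  exact (PiLp.volume_preserving_ofLp (Fin n)).measurable
    (MeasurableSet.univ_pi fun _ => measurableSet_Ico)

lemma volume_gridCube (hh : 0 < h) (v : Fin n → ℤ) :
    volume (gridCube h v) = ENNReal.ofReal (h ^ n) := by
  rw [gridCube_eq_preimage hh, (PiLp.volume_preserving_ofLp (Fin n)).measure_preimage
    (MeasurableSet.univ_pi fun _ => measurableSet_Ico).nullMeasurableSet, Real.volume_pi_Ico]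
  simp [add_mul, ENNReal.ofReal_pow hh.le]

lemma pairwise_disjoint_gridCube :
    Pairwise (Function.onFun Disjoint (gridCube (n := n) h)) := by
  intro v w hvw
  refine Set.disjoint_left.2 fun x hv hw => hvw (funext fun i => ?_)
  rw [← hv i, hw i]

lemma norm_sub_le_of_mem_gridCube (hh : 0 < h) {v : Fin n → ℤ} {x y : EuclideanSpace ℝ (Fin n)}
    (hx : x ∈ gridCube h v) (hy : y ∈ gridCube h v) : ‖x - y‖ ≤ √n * h := by
  rw [gridCube_eq_preimage hh] at hx hy
  have hi : ∀ i ∈ Finset.univ, ‖(x - y) i‖ ^ 2 ≤ h ^ 2 := by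
    intro i _
    have h1 := hx i (Set.mem_univ i)
    have h2 := hy i (Set.mem_univ i)
    rw [Set.mem_Ico] at h1 h2
    have : ‖(x - y) i‖ ≤ h := by
      rw [PiLp.sub_apply, Real.norm_eq_abs, abs_le]
      constructor <;> linarith [h1.1, h1.2, h2.1, h2.2]
    gcongr
  rw [EuclideanSpace.norm_eq]
  refine Real.sqrt_le_iff.2 ⟨by positivity, (Finset.sum_le_sum hi).trans ?_⟩
  simp [mul_pow]

lemma finite_setOf_gridCube_inter_ball_nonempty (hh : 0 < h) (R : ℝ) :
    {v : Fin n → ℤ | (gridCube h v ∩ ball 0 R).Nonempty}.Finite := by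
  refine (Set.finite_Icc (fun _ => ⌊-R / h⌋) (fun _ => ⌊R / h⌋)).subset ?_
  rintro v ⟨x, hv, hx⟩
  have hxi (i : Fin n) : |x i| ≤ R := by
    rw [mem_ball_zero_iff] at hx
    exact (PiLp.norm_apply_le x i).trans hx.le
  refine ⟨fun i => ?_, fun i => ?_⟩ <;> rw [← hv i] <;> apply Int.floor_mono <;> gcongr
  · exact (abs_le.1 (hxi i)).1
  · exact (abs_le.1 (hxi i)).2

end GridCube

lemma ENNReal.min_mul_add_le (a b : ℝ≥0∞) : min a b * (a + b) ≤ 2 * (a * b) := by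
  rcases le_total a b with hab | hab
  · calc min a b * (a + b) ≤ a * (b + b) := by gcongr; exact min_le_left _ _
      _ = 2 * (a * b) := by ring
  · calc min a b * (a + b) ≤ b * (a + a) := by gcongr; exact min_le_right _ _
      _ = 2 * (a * b) := by ring

lemma min_volume_mul_le_lintegral {n : ℕ} {β d : ℝ} (hβ : 0 ≤ β)
    {E Q : Set (EuclideanSpace ℝ (Fin n))} (hE : MeasurableSet E) (hQ : MeasurableSet Q)
    (hd : ∀ x ∈ Q, ∀ y ∈ Q, ‖x - y‖ ≤ d) :
    min (volume (Q ∩ E)) (volume (Q \ E)) * (volume Q * ENNReal.ofReal (d ^ (-β))) ≤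
      2 * ∫⁻ x in Q ∩ E, ∫⁻ y in Eᶜ, ENNReal.ofReal (‖x - y‖ ^ (-β)) := by
  have key : volume (Q ∩ E) * volume (Q \ E) * ENNReal.ofReal (d ^ (-β)) ≤
      ∫⁻ x in Q ∩ E, ∫⁻ y in Eᶜ, ENNReal.ofReal (‖x - y‖ ^ (-β)) := by
    calc volume (Q ∩ E) * volume (Q \ E) * ENNReal.ofReal (d ^ (-β))
        = ∫⁻ _ in Q ∩ E, ∫⁻ _ in Q \ E, ENNReal.ofReal (d ^ (-β)) := by
          simp only [setLIntegral_const]; ring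
      _ ≤ ∫⁻ x in Q ∩ E, ∫⁻ y in Q \ E, ENNReal.ofReal (‖x - y‖ ^ (-β)) := by
          refine setLIntegral_mono' (hQ.inter hE) fun x hx =>
            setLIntegral_mono' (hQ.diff hE) fun y hy => ENNReal.ofReal_le_ofReal ?_
          have hxy : x ≠ y := fun hxy => hy.2 (hxy ▸ hx.2)
          exact Real.rpow_le_rpow_of_nonpos (norm_sub_pos_iff.2 hxy) (hd x hx.1 y hy.1)
            (neg_nonpos.2 hβ)
      _ ≤ _ := lintegral_mono fun x => lintegral_mono_set fun y hy => hy.2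
  calc _ = min (volume (Q ∩ E)) (volume (Q \ E)) * (volume (Q ∩ E) + volume (Q \ E)) *
        ENNReal.ofReal (d ^ (-β)) := by rw [measure_inter_add_sdiff Q hE, mul_assoc]
    _ ≤ 2 * (volume (Q ∩ E) * volume (Q \ E)) * ENNReal.ofReal (d ^ (-β)) := by
        gcongr ?_ * _; exact ENNReal.min_mul_add_le _ _
    _ ≤ _ := by rw [mul_assoc]; gcongr

lemma exists_volume_symmDiff_biUnion_gridCube_mul_le {n : ℕ} {α h : ℝ} (hα : 0 < α) (hh : 0 < h)
    {E : Set (EuclideanSpace ℝ (Fin n))} (hE : MeasurableSet E) {S : Finset (Fin n → ℤ)}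
    (hS : E ⊆ ⋃ v ∈ S, gridCube h v) :
    ∃ T ⊆ S, volume (symmDiff E (⋃ v ∈ T, gridCube h v)) *
        (ENNReal.ofReal (h ^ n) * ENNReal.ofReal ((√n * h) ^ (-((n : ℝ) + α)))) ≤
      2 * fracPerimeter n α E := by
  classical
  set T := {v ∈ S | volume (gridCube h v \ E) ≤ volume (gridCube h v ∩ E)} with hT
  let D (v : Fin n → ℤ) : Set (EuclideanSpace ℝ (Fin n)) :=
    if v ∈ T then gridCube h v \ E else gridCube h v ∩ E
  have hD : ∀ v ∈ S, volume (D v) =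
      min (volume (gridCube h v ∩ E)) (volume (gridCube h v \ E)) := by
    intro v hv
    by_cases hvT : volume (gridCube h v \ E) ≤ volume (gridCube h v ∩ E)
    · simp [D, hT, hv, hvT]
    · simp [D, hT, hvT, (not_le.1 hvT).le]
  have hsub : symmDiff E (⋃ v ∈ T, gridCube h v) ⊆ ⋃ v ∈ S, D v := by
    rintro x (⟨hxE, hxT⟩ | ⟨hxT, hxE⟩)
    · obtain ⟨v, hv, hxv⟩ := Set.mem_iUnion₂.1 (hS hxE)
      have hvT : v ∉ T := fun hvT => hxT (Set.mem_iUnion₂.2 ⟨v, hvT, hxv⟩)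
      exact Set.mem_iUnion₂.2 ⟨v, hv, by simpa [D, hvT] using ⟨hxv, hxE⟩⟩
    · obtain ⟨v, hvT, hxv⟩ := Set.mem_iUnion₂.1 hxT
      exact Set.mem_iUnion₂.2 ⟨v, Finset.filter_subset _ _ hvT, by
        simpa only [D, if_pos hvT] using ⟨hxv, hxE⟩⟩
  refine ⟨T, Finset.filter_subset _ _, ?_⟩
  calc _ ≤ (∑ v ∈ S, volume (D v)) *
        (ENNReal.ofReal (h ^ n) * ENNReal.ofReal ((√n * h) ^ (-((n : ℝ) + α)))) := by
        gcongr
        exact (measure_mono hsub).trans (measure_biUnion_finset_le S D)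
    _ ≤ ∑ v ∈ S, 2 * ∫⁻ x in gridCube h v ∩ E, ∫⁻ y in Eᶜ,
          ENNReal.ofReal (‖x - y‖ ^ (-((n : ℝ) + α))) := by
        rw [Finset.sum_mul]
        refine Finset.sum_le_sum fun v hv => ?_
        rw [hD v hv, ← volume_gridCube hh v]
        exact min_volume_mul_le_lintegral (by positivity) hE (measurableSet_gridCube hh v)
          fun x hx y hy => norm_sub_le_of_mem_gridCube hh hx hy
    _ = 2 * ∫⁻ x in ⋃ v ∈ S, gridCube h v ∩ E, ∫⁻ y in Eᶜ,
          ENNReal.ofReal (‖x - y‖ ^ (-((n : ℝ) + α))) := by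
        rw [← Finset.mul_sum, lintegral_biUnion_finset]
        · exact fun v _ w _ hvw => (pairwise_disjoint_gridCube hvw).mono inter_subset_left
            inter_subset_left
        · exact fun v _ => (measurableSet_gridCube hh v).inter hE
    _ ≤ 2 * fracPerimeter n α E := by
        unfold fracPerimeter
        gcongr
        exact Set.iUnion₂_subset fun v _ => inter_subset_right

lemma tendsto_grid_constant {n : ℕ} (hn : 1 ≤ n) {α : ℝ} (hα : 0 < α) :
    Tendsto (fun h : ℝ => ENNReal.ofReal (h ^ n) *
      ENNReal.ofReal ((√n * h) ^ (-((n : ℝ) + α)))) (𝓝[>] 0) (𝓝 ∞) := by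
  have hc : 0 < √(n : ℝ) ^ (-((n : ℝ) + α)) := by positivity
  have hlim := ENNReal.tendsto_ofReal_atTop.comp
    ((tendsto_rpow_neg_nhdsGT_zero (y := -α) (by linarith)).const_mul_atTop hc)
  refine hlim.congr' ?_
  filter_upwards [self_mem_nhdsWithin] with h hh
  have hh : 0 < h := hh
  rw [Function.comp_apply, ← ENNReal.ofReal_mul (by positivity), Real.mul_rpow (by positivity) hh.le,
    mul_left_comm, ← Real.rpow_natCast, ← Real.rpow_add hh]
  congr 3
  ring

open scoped symmDiff in
instance {X : Type*} [MeasurableSpace X] {μ : Measure X} : CompleteSpace (MeasuredSets μ) := by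
  refine EMetric.complete_of_convergent_controlled_sequences (fun n => 2⁻¹ ^ (n + 1))
    (fun n => ENNReal.pow_pos (by simp) _) fun u hu => ?_
  let D (n : ℕ) : Set X := (u n : Set X) ∆ u (n + 1)
  have hD (n : ℕ) : μ (D n) ≤ 2⁻¹ ^ (n + 1) := (hu n n (n + 1) le_rfl n.le_succ).le
  let F : Set X := ⋂ n, ⋃ i ≥ n, (u i : Set X)
  have hF : MeasurableSet F :=
    .iInter fun n => .iUnion fun i => .iUnion fun _ => (u i).2
  have hsub (N : ℕ) : (u N : Set X) ∆ F ⊆ ⋃ k, D (N + k) := by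
    intro x hx
    by_contra hxD
    have hstep (k : ℕ) : x ∈ (u (N + k) : Set X) ↔ x ∈ (u N : Set X) := by
      induction k with
      | zero => rfl
      | succ k ih =>
        have : x ∉ D (N + k) := fun h => hxD (Set.mem_iUnion.2 ⟨k, h⟩)
        simp only [D, Set.mem_symmDiff, add_assoc] at this
        tauto
    have hxF : x ∈ F ↔ x ∈ (u N : Set X) := by
      simp only [F, Set.mem_iInter, Set.mem_iUnion, exists_prop]
      refine ⟨fun h => ?_, fun h m => ⟨N + m, by lia, (hstep m).2 h⟩⟩
      obtain ⟨i, hi, hxi⟩ := h N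
      obtain ⟨k, rfl⟩ := Nat.exists_eq_add_of_le hi
      exact (hstep k).1 hxi
    rw [Set.mem_symmDiff] at hx
    tauto
  have hle (N : ℕ) : edist (u N) ⟨F, hF⟩ ≤ 2⁻¹ ^ N := by
    calc μ ((u N : Set X) ∆ F) ≤ ∑' k, μ (D (N + k)) :=
          (measure_mono (hsub N)).trans (measure_iUnion_le _)
      _ ≤ ∑' k, (2⁻¹ : ℝ≥0∞) ^ N * 2⁻¹ ^ (k + 1) := by
          gcongr with k
          rw [← pow_add]
          exact hD (N + k)
      _ = 2⁻¹ ^ N := by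
          rw [ENNReal.tsum_mul_left, ENNReal.tsum_geometric_add_one, ENNReal.one_sub_inv_two,
            inv_inv, ENNReal.inv_mul_cancel two_ne_zero ENNReal.ofNat_ne_top, mul_one]
  refine ⟨⟨F, hF⟩, tendsto_iff_edist_tendsto_0.2 ?_⟩
  exact tendsto_of_tendsto_of_tendsto_of_le_of_le tendsto_const_nhds
    (ENNReal.tendsto_pow_atTop_nhds_zero_of_lt_one (by simp)) (fun _ => zero_le) hle

lemma totallyBounded_setOf_fracPerimeter_le {n : ℕ} (hn : 1 ≤ n) {α : ℝ} (hα : 0 < α) (R : ℝ)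
    {C : ℝ≥0∞} (hC : C ≠ ∞) :
    TotallyBounded {s : MeasuredSets (volume : Measure (EuclideanSpace ℝ (Fin n))) |
      (s : Set (EuclideanSpace ℝ (Fin n))) ⊆ ball 0 R ∧ fracPerimeter n α s ≤ C} := by
  rw [EMetric.totallyBounded_iff]
  intro ε hε
  have h2C : 2 * C / ε < ∞ := by finiteness
  obtain ⟨h, hlt, hh⟩ := (((tendsto_order.1 (tendsto_grid_constant hn hα)).1 _ h2C).and
    self_mem_nhdsWithin).exists
  have hh : 0 < h := hh
  set S := (finite_setOf_gridCube_inter_ball_nonempty (n := n) hh R).toFinset with hS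
  let G (T : Finset (Fin n → ℤ)) : MeasuredSets (volume : Measure (EuclideanSpace ℝ (Fin n))) :=
    ⟨⋃ v ∈ T, gridCube h v, T.measurableSet_biUnion fun v _ => measurableSet_gridCube hh v⟩
  refine ⟨G '' ↑S.powerset, S.powerset.finite_toSet.image _, ?_⟩
  rintro s ⟨hsR, hsC⟩
  have hsS : (s : Set (EuclideanSpace ℝ (Fin n))) ⊆ ⋃ v ∈ S, gridCube h v := fun x hx =>
    Set.mem_iUnion₂.2 ⟨fun i => ⌊x i / h⌋,
      by simpa [hS] using ⟨x, fun _ => rfl, by simpa using hsR hx⟩, fun _ => rfl⟩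
  obtain ⟨T, hTS, hT⟩ := exists_volume_symmDiff_biUnion_gridCube_mul_le hα hh s.2 hsS
  refine Set.mem_iUnion₂.2 ⟨G T, ⟨T, by simpa using hTS, rfl⟩, ?_⟩
  by_contra hge
  have hge : ε ≤ volume (symmDiff (s : Set (EuclideanSpace ℝ (Fin n))) (⋃ v ∈ T, gridCube h v)) :=
    not_lt.1 hge
  refine hlt.not_ge ?_
  rw [ENNReal.le_div_iff_mul_le (.inl hε.ne') (.inr (by finiteness)), mul_comm]
  calc _ ≤ _ := mul_le_mul_left hge _
    _ ≤ 2 * fracPerimeter n α s := hT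
    _ ≤ 2 * C := by gcongr

/-- Compactness: a sequence of subsets of a fixed ball with uniformly bounded fractional
perimeter has a subsequence converging in measure to a measurable subset of the ball. -/
theorem stmt_17 (n : ℕ) (hn : 1 ≤ n) (α : ℝ) (hα : α ∈ Set.Ioo (0 : ℝ) 1)
    (R : ℝ) (hR : 0 < R)
    (E : ℕ → Set (EuclideanSpace ℝ (Fin n))) (hEmeas : ∀ k, MeasurableSet (E k))
    (hER : ∀ k, E k ⊆ ball (0 : EuclideanSpace ℝ (Fin n)) R)
    (hbdd : ∃ C : ℝ≥0∞, C ≠ ⊤ ∧ ∀ k, fracPerimeter n α (E k) ≤ C) :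
    ∃ φ : ℕ → ℕ, StrictMono φ ∧
      ∃ F : Set (EuclideanSpace ℝ (Fin n)), MeasurableSet F ∧
        F ⊆ ball (0 : EuclideanSpace ℝ (Fin n)) R ∧
        Tendsto (fun j => volume (symmDiff (E (φ j)) F)) atTop (𝓝 0) := by
  obtain ⟨C, hC, hEC⟩ := hbdd
  let u (k : ℕ) : MeasuredSets (volume : Measure (EuclideanSpace ℝ (Fin n))) := ⟨E k, hEmeas k⟩
  obtain ⟨G, -, φ, hφ, hG⟩ := ((totallyBounded_setOf_fracPerimeter_le hn hα.1 R
    hC).closure.isCompact_of_isClosed isClosed_closure).isSeqCompact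
    (x := u) fun k => subset_closure ⟨hER k, hEC k⟩
  refine ⟨φ, hφ, G ∩ ball 0 R, G.2.inter measurableSet_ball, inter_subset_right, ?_⟩
  refine tendsto_of_tendsto_of_tendsto_of_le_of_le tendsto_const_nhds
    (tendsto_iff_edist_tendsto_0.1 hG) (fun _ => zero_le) fun j => measure_mono ?_
  intro x hx
  have hxR := @hER (φ j) x
  simp only [Set.mem_symmDiff, Set.mem_inter_iff] at hx ⊢
  change x ∈ E (φ j) ∧ x ∉ G ∨ x ∈ G ∧ x ∉ E (φ j)
  tauto
end
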